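/- Let A be an N×N complex matrix and let μ be the uniform probability measure on the unit sphere Ω_N of ℂ^N. Then A has rotation-invariant numerical shadow (i.e. for every θ ∈ ℝ the pushforward of μ under u ↦ ⟨(e^{iθ}A)u, u⟩ equals the pushforward of μ under u ↦ ⟨Au,u⟩) if and only if det(I − s e^{iθ}A − t e^{−iθ}A*) = det(I − sA − tA*) for all real s, t and all θ ∈ ℝ (equivalently, det(I − sA − tA*), as a polynomial in s and t, is a function of the product st). -/

import Mathlib

open MeasureTheory Matrix

/-- The quadratic form `⟨Au,u⟩ = u*Au = ∑_{i,j} conj(u_i) A_{ij} u_j`. -/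
noncomputable def qf {ι : Type*} [Fintype ι] (A : Matrix ι ι ℂ) (u : EuclideanSpace ℂ ι) : ℂ :=
  ∑ i, ∑ j, (starRingEnd ℂ) (u i) * A i j * u j

/-- `μ` is the uniform probability measure on the unit sphere `Ω = {u : ‖u‖ = 1}` of `ℂ^ι`:
a Borel probability measure concentrated on the sphere and invariant under the unitary group. -/
def IsUniformOnSphere {ι : Type*} [Fintype ι] [DecidableEq ι]
    [MeasurableSpace (EuclideanSpace ℂ ι)] [BorelSpace (EuclideanSpace ℂ ι)]
    (μ : Measure (EuclideanSpace ℂ ι)) : Prop :=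
  IsProbabilityMeasure μ ∧ μ (Metric.sphere 0 1) = 1 ∧
    ∀ U ∈ Matrix.unitaryGroup ι ℂ, μ.map (fun u => Matrix.toEuclideanLin U u) = μ

open Complex Module
open scoped ComplexConjugate

section QuadraticForm

variable {ι : Type*} [Fintype ι]

lemma qf_eq_inner [DecidableEq ι] (A : Matrix ι ι ℂ) (u : EuclideanSpace ℂ ι) :
    qf A u = inner ℂ u (Matrix.toEuclideanLin A u) := by
  simp only [qf, PiLp.inner_apply, RCLike.inner_apply, Matrix.toLpLin_apply, mulVec,
    dotProduct, Finset.sum_mul]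
  exact Finset.sum_congr rfl fun i _ => Finset.sum_congr rfl fun j _ => by ring

lemma continuous_qf (A : Matrix ι ι ℂ) : Continuous (qf A) := by
  unfold qf
  fun_prop

lemma qf_smul (c : ℂ) (A : Matrix ι ι ℂ) (u : EuclideanSpace ℂ ι) :
    qf (c • A) u = c * qf A u := by
  simp only [qf, Finset.mul_sum, Matrix.smul_apply, smul_eq_mul]
  exact Finset.sum_congr rfl fun i _ => Finset.sum_congr rfl fun j _ => by ring

lemma qf_apply_smul (A : Matrix ι ι ℂ) (r : ℝ) (u : EuclideanSpace ℂ ι) :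
    qf A (r • u) = (r : ℂ) ^ 2 * qf A u := by
  simp only [qf, Finset.mul_sum, PiLp.smul_apply, real_smul, map_mul, conj_ofReal]
  exact Finset.sum_congr rfl fun i _ => Finset.sum_congr rfl fun j _ => by ring

lemma qf_add_conjTranspose (B : Matrix ι ι ℂ) (u : EuclideanSpace ℂ ι) :
    qf (B + Bᴴ) u = ((2 * (qf B u).re : ℝ) : ℂ) := by
  have h : qf (B + Bᴴ) u = qf B u + conj (qf B u) := by
    simp only [qf, map_sum, map_mul, Matrix.add_apply, Matrix.conjTranspose_apply, mul_add, add_mul,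
      Finset.sum_add_distrib, conj_conj]
    congr 1
    rw [Finset.sum_comm]
    exact Finset.sum_congr rfl fun i _ => Finset.sum_congr rfl fun j _ => by
      simp only [RCLike.star_def]; ring
  rw [h, add_conj]

lemma qf_of_isHermitian [DecidableEq ι] {H : Matrix ι ι ℂ} (hH : H.IsHermitian)
    (u : EuclideanSpace ℂ ι) :
    qf H u = ((∑ i, hH.eigenvalues i * ‖hH.eigenvectorBasis.repr u i‖ ^ 2 : ℝ) : ℂ) := by
  have hcoord (i : ι) : inner ℂ (hH.eigenvectorBasis i) (Matrix.toEuclideanLin H u) =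
      hH.eigenvalues i * inner ℂ (hH.eigenvectorBasis i) u := by
    have hs : (Matrix.toEuclideanLin H).IsSymmetric := Matrix.isSymmetric_toEuclideanLin_iff.mpr hH
    have he : Matrix.toEuclideanLin H (hH.eigenvectorBasis i) =
        (hH.eigenvalues i : ℂ) • hH.eigenvectorBasis i := by
      ext j
      have := congrFun (hH.mulVec_eigenvectorBasis i) j
      simpa [Matrix.toLpLin_apply] using this
    rw [← hs, he, inner_smul_left, conj_ofReal]
  rw [qf_eq_inner, ← hH.eigenvectorBasis.sum_inner_mul_inner, ofReal_sum]
  refine Finset.sum_congr rfl fun i _ => ?_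
  rw [hcoord, OrthonormalBasis.repr_apply_apply, ← inner_conj_symm, mul_left_comm, conj_mul',
    ofReal_mul, ofReal_pow]

end QuadraticForm

section Determinant

variable {ι : Type*} [Fintype ι] [DecidableEq ι]

lemma det_one_sub_smul_eq_eval_charpolyRev {R : Type*} [CommRing R] (M : Matrix ι ι R) (x : R) :
    (1 - x • M).det = M.charpolyRev.eval x := by
  rw [Matrix.charpolyRev, ← Polynomial.coe_evalRingHom, RingHom.map_det]
  congr 1
  ext i j
  by_cases h : i = j <;> simp [h, mul_comm x]

lemma det_one_sub_smul_eq_of_infinite {R : Type*} [CommRing R] [IsDomain R] {M M' : Matrix ι ι R}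
    {S : Set R} (hS : S.Infinite) (h : ∀ x ∈ S, (1 - x • M).det = (1 - x • M').det) (x : R) :
    (1 - x • M).det = (1 - x • M').det := by
  simp only [det_one_sub_smul_eq_eval_charpolyRev] at h ⊢
  rw [Polynomial.eq_of_infinite_eval_eq _ _ (hS.mono h)]

lemma det_one_sub_smul_eq_pow_mul_eval_charpoly {K : Type*} [Field K] (M : Matrix ι ι K) {x : K}
    (hx : x ≠ 0) : (1 - x • M).det = x ^ Fintype.card ι * M.charpoly.eval x⁻¹ := by
  rw [Matrix.eval_charpoly, ← Matrix.det_smul]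
  congr 1
  ext i j
  by_cases h : i = j <;> simp [h, mul_sub, hx]

lemma charpoly_eq_of_det_one_sub_smul_eq {K : Type*} [Field K] [Infinite K] {M M' : Matrix ι ι K}
    (h : ∀ x : K, (1 - x • M).det = (1 - x • M').det) : M.charpoly = M'.charpoly := by
  refine Polynomial.eq_of_infinite_eval_eq _ _
    ((Set.finite_singleton (0 : K)).infinite_compl.mono fun y hy => ?_)
  have hy : y ≠ 0 := hy
  have := h y⁻¹
  rw [det_one_sub_smul_eq_pow_mul_eval_charpoly _ (inv_ne_zero hy),
    det_one_sub_smul_eq_pow_mul_eval_charpoly _ (inv_ne_zero hy), inv_inv] at this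
  exact mul_left_cancel₀ (pow_ne_zero _ (inv_ne_zero hy)) this

lemma det_one_sub_smul_of_isHermitian {H : Matrix ι ι ℂ} (hH : H.IsHermitian) (x : ℂ) :
    (1 - x • H).det = ∏ i, (1 - x * hH.eigenvalues i) := by
  rcases eq_or_ne x 0 with rfl | hx
  · simp
  · rw [det_one_sub_smul_eq_pow_mul_eval_charpoly _ hx, hH.charpoly_eq, Polynomial.eval_prod,
      ← Finset.card_univ, ← Finset.prod_const, ← Finset.prod_mul_distrib]
    exact Finset.prod_congr rfl fun i _ => by simp [mul_sub, hx]

/-- If `(z, w) ↦ det (1 - z A - w B)` is invariant under `(x, x) ↦ (cx, c⁻¹x)` for `|c| = 1`, then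
it only depends on `zw`, at least away from the coordinate axes. -/
lemma det_one_sub_smul_sub_smul_eq_of_forall_norm_eq_one {A B : Matrix ι ι ℂ}
    (h : ∀ x c : ℂ, ‖c‖ = 1 →
      (1 - (x * c) • A - (x * c⁻¹) • B).det = (1 - x • A - x • B).det)
    {x c : ℂ} (hc : c ≠ 0) :
    (1 - (x * c) • A - (x * c⁻¹) • B).det = (1 - x • A - x • B).det := by
  let P : Polynomial ℂ := ((Polynomial.X : Polynomial ℂ) • (1 : Matrix ι ι (Polynomial ℂ))
    - (Polynomial.C x * Polynomial.X ^ 2) • A.map Polynomial.C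
    - Polynomial.C x • B.map Polynomial.C).det
  have hP (c : ℂ) (hc : c ≠ 0) :
      P.eval c = c ^ Fintype.card ι * (1 - (x * c) • A - (x * c⁻¹) • B).det := by
    rw [← Matrix.det_smul, ← Polynomial.coe_evalRingHom, RingHom.map_det]
    congr 1
    ext i j
    simp only [RingHom.mapMatrix_apply, Matrix.map_apply, Matrix.sub_apply, Matrix.smul_apply,
      Matrix.one_apply, smul_eq_mul, map_sub, Polynomial.coe_evalRingHom]
    split_ifs <;> simp <;> field_simp
  have hPQ : P = Polynomial.X ^ Fintype.card ι * Polynomial.C (1 - x • A - x • B).det := by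
    refine Polynomial.eq_of_infinite_eval_eq _ _ (Set.Infinite.mono (s := Metric.sphere 0 1) ?_ ?_)
    · intro c hc
      have hc1 : ‖c‖ = 1 := by simpa using hc
      have hc0 : c ≠ 0 := by rintro rfl; simp at hc1
      rw [Set.mem_ofPred_eq, hP c hc0, h x c hc1]
      simp [mul_comm (c ^ _)]
    · refine (isPreconnected_sphere (by simp [Complex.rank_real_complex]) 0 1).infinite_of_nontrivial
        ⟨1, by simp, -1, by simp, by norm_num⟩
  have := hP c hc
  rw [hPQ, Polynomial.eval_mul, Polynomial.eval_C, Polynomial.eval_pow, Polynomial.eval_X] at this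
  exact (mul_left_cancel₀ (pow_ne_zero _ hc) this).symm

lemma det_one_sub_smul_sub_smul_mul_eq {A B : Matrix ι ι ℂ}
    (h : ∀ x c : ℂ, ‖c‖ = 1 →
      (1 - (x * c) • A - (x * c⁻¹) • B).det = (1 - x • A - x • B).det)
    (s t : ℂ) {c : ℂ} (hc : c ≠ 0) :
    (1 - (s * c) • A - (t * c⁻¹) • B).det = (1 - s • A - t • B).det := by
  have key (s t : ℂ) (hs : s ≠ 0) (ht : t ≠ 0) (c : ℂ) (hc : c ≠ 0) :
      (1 - (s * c) • A - (t * c⁻¹) • B).det = (1 - s • A - t • B).det := by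
    obtain ⟨x, hx⟩ := IsAlgClosed.exists_pow_nat_eq (s * t) two_pos
    have hx0 : x ≠ 0 := by
      rintro rfl
      exact mul_ne_zero hs ht (by rw [← hx]; simp)
    have ht' : t = x ^ 2 / s := by field_simp; rw [hx]; ring
    have h1 := det_one_sub_smul_sub_smul_eq_of_forall_norm_eq_one h (x := x) (c := s / x * c)
      (by positivity)
    have h2 := det_one_sub_smul_sub_smul_eq_of_forall_norm_eq_one h (x := x) (c := s / x)
      (by positivity)
    rw [← h2] at h1
    have e1 : x * (s / x * c) = s * c := by field_simp
    have e2 : x * (s / x) = s := by field_simp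
    have e3 : x * (s / x * c)⁻¹ = t * c⁻¹ := by rw [ht']; field_simp
    have e4 : x * (s / x)⁻¹ = t := by rw [ht']; field_simp
    rwa [e1, e2, e3, e4] at h1
  have hcont (a b : ℂ) : Continuous fun e : ℂ => (1 - ((s + e) * a) • A - ((t + e) * b) • B).det := by
    fun_prop
  have hd : Dense ({-s, -t}ᶜ : Set ℂ) := (Set.toFinite _).countable.dense_compl ℂ
  have := Continuous.ext_on hd (hcont c c⁻¹) (hcont 1 1) fun e he => by
    simp only [Set.mem_compl_iff, Set.mem_insert_iff, Set.mem_singleton_iff, not_or] at he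
    simpa using key (s + e) (t + e) (fun h0 => he.1 (by linear_combination h0))
      (fun h0 => he.2 (by linear_combination h0)) c hc
  simpa using congrFun this 0

end Determinant

section Radial

variable {E : Type*} [NormedAddCommGroup E] [InnerProductSpace ℝ E] [FiniteDimensional ℝ E]
  [MeasurableSpace E] [BorelSpace E]

/-- A finite measure with radial characteristic function is invariant under linear isometries. -/
lemma map_linearIsometryEquiv_eq_of_charFun_radial {γ : Measure E} [IsFiniteMeasure γ]
    (hγ : ∀ v w, ‖v‖ = ‖w‖ → charFun γ v = charFun γ w) (e : E ≃ₗᵢ[ℝ] E) : γ.map e = γ := by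
  refine Measure.ext_of_charFun (funext fun t => ?_)
  rw [charFun_apply, integral_map e.continuous.aemeasurable (by fun_prop)]
  rw [← hγ (e.symm t) t (by simp), charFun_apply]
  simp [e.inner_map_eq_flip]

/-- A rotation-invariant finite measure is the distribution of `‖z‖ • u`, where `z` is distributed
according to the measure itself and `u` is uniform on the sphere and independent of `z`. -/
lemma map_norm_smul_prod_eq_of_charFun_radial {γ μ : Measure E} [IsFiniteMeasure γ]
    [IsProbabilityMeasure μ] (hμ1 : μ (Metric.sphere 0 1) = 1)
    (hγ : ∀ v w, ‖v‖ = ‖w‖ → charFun γ v = charFun γ w)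
    (hμ : ∀ v w, ‖v‖ = ‖w‖ → charFun μ v = charFun μ w) :
    (γ.prod μ).map (fun p => ‖p.1‖ • p.2) = γ := by
  have hc : Continuous fun p : E × E => ‖p.1‖ • p.2 := by fun_prop
  refine Measure.ext_of_charFun (funext fun t => ?_)
  have hint (ν ν' : Measure E) [IsFiniteMeasure ν] [IsFiniteMeasure ν'] (f : E × E → ℝ)
      (hf : Continuous f) : Integrable (fun p => Complex.exp (f p * I)) (ν.prod ν') := by
    refine Integrable.of_bound (C := 1) (by fun_prop) (ae_of_all _ fun p => ?_)
    rw [Complex.norm_exp_ofReal_mul_I]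
  have hsph : ∀ᵐ u ∂μ, ‖u‖ = 1 := by
    have := (prob_compl_eq_zero_iff Metric.isClosed_sphere.measurableSet).mpr hμ1
    filter_upwards [compl_mem_ae_iff.mpr this] with u hu
    simpa using hu
  calc charFun ((γ.prod μ).map (fun p => ‖p.1‖ • p.2)) t
      = ∫ z, charFun μ (‖z‖ • t) ∂γ := by
        rw [charFun_apply, integral_map hc.aemeasurable (by fun_prop),
          integral_prod _ (hint γ μ _ (by fun_prop))]
        simp only [charFun_apply, inner_smul_left, inner_smul_right, conj_trivial]
    _ = ∫ z, charFun μ (‖t‖ • z) ∂γ :=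
        integral_congr_ae (ae_of_all _ fun z => hμ _ _ (by simp [norm_smul, mul_comm]))
    _ = ∫ u, charFun γ (‖t‖ • u) ∂μ := by
        simp only [charFun_apply]
        rw [integral_integral_swap (hint γ μ (fun p => inner ℝ p.2 (‖t‖ • p.1)) (by fun_prop))]
        simp only [inner_smul_right, real_inner_comm]
    _ = ∫ _, charFun γ t ∂μ :=
        integral_congr_ae (hsph.mono fun u hu => hγ _ _ (by simp [norm_smul, hu]))
    _ = charFun γ t := by simp

end Radial

section Gaussian

/-- The measure on `ℂ` with density `exp (-|z|²)`. -/
noncomputable def expNegSqMeasure : Measure ℂ :=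
  volume.withDensity fun z => ENNReal.ofReal (Real.exp (-‖z‖ ^ 2))

lemma integral_expNegSqMeasure {F : Type*} [NormedAddCommGroup F] [NormedSpace ℝ F] (f : ℂ → F) :
    ∫ z, f z ∂expNegSqMeasure = ∫ z, Real.exp (-‖z‖ ^ 2) • f z := by
  rw [expNegSqMeasure, integral_withDensity_eq_integral_toReal_smul (by fun_prop) (by simp)]
  simp [ENNReal.toReal_ofReal (Real.exp_nonneg _)]

instance : IsFiniteMeasure expNegSqMeasure := by
  refine isFiniteMeasure_withDensity_ofReal (Integrable.hasFiniteIntegral ?_)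
  have := (GaussianFourier.integrable_cexp_neg_mul_sq_norm_add (V := ℂ) (b := 1) (by simp) 0 0).norm
  refine this.congr (ae_of_all _ fun z => ?_)
  simp [Complex.norm_exp, ← ofReal_pow]

lemma charFun_expNegSqMeasure (t : ℂ) :
    charFun expNegSqMeasure t = Real.pi * Complex.exp (-‖t‖ ^ 2 / 4) := by
  rw [charFun_apply, integral_expNegSqMeasure]
  have := GaussianFourier.integral_cexp_neg_mul_sq_norm_add (V := ℂ) (b := 1) (by simp) I t
  simp only [Complex.finrank_real_complex] at this
  convert this using 1
  · refine integral_congr_ae (ae_of_all _ fun z => ?_)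
    simp only [real_smul, ofReal_exp, ← Complex.exp_add, real_inner_comm z t]
    push_cast
    ring_nf
  · simp

lemma integral_exp_expNegSqMeasure {a : ℝ} (ha : a < 1) :
    ∫ z, Real.exp (a * ‖z‖ ^ 2) ∂expNegSqMeasure = Real.pi / (1 - a) := by
  rw [integral_expNegSqMeasure]
  have := GaussianFourier.integral_rexp_neg_mul_sq_norm (V := ℂ) (b := 1 - a) (by linarith)
  simp only [Complex.finrank_real_complex] at this
  convert this using 1
  · refine integral_congr_ae (ae_of_all _ fun z => ?_)
    simp only [smul_eq_mul, ← Real.exp_add]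
    ring_nf
  · simp

variable (ι : Type*) [Fintype ι]

/-- The measure on `ℂ^ι` with density `exp (-‖z‖²)`, as a product measure. -/
noncomputable def expNegSqMeasurePi : Measure (EuclideanSpace ℂ ι) :=
  (Measure.pi fun _ => expNegSqMeasure).map (WithLp.toLp 2)

instance : IsFiniteMeasure (expNegSqMeasurePi ι) := by
  unfold expNegSqMeasurePi
  infer_instance

lemma charFun_expNegSqMeasurePi (t : EuclideanSpace ℂ ι) :
    charFun (expNegSqMeasurePi ι) t =
      Real.pi ^ Fintype.card ι * Complex.exp (-‖t‖ ^ 2 / 4) := by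
  rw [expNegSqMeasurePi, charFun_pi]
  simp only [charFun_expNegSqMeasure, Finset.prod_mul_distrib, ← Complex.exp_sum]
  simp [← ofReal_pow, EuclideanSpace.norm_sq_eq, neg_div, Finset.sum_div]

variable {ι}

lemma charFun_expNegSqMeasurePi_eq {v w : EuclideanSpace ℂ ι} (h : ‖v‖ = ‖w‖) :
    charFun (expNegSqMeasurePi ι) v = charFun (expNegSqMeasurePi ι) w := by
  rw [charFun_expNegSqMeasurePi, charFun_expNegSqMeasurePi, h]

lemma map_expNegSqMeasurePi (e : EuclideanSpace ℂ ι ≃ₗᵢ[ℂ] EuclideanSpace ℂ ι) :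
    (expNegSqMeasurePi ι).map e = expNegSqMeasurePi ι :=
  map_linearIsometryEquiv_eq_of_charFun_radial (fun _ _ => charFun_expNegSqMeasurePi_eq)
    { e.toLinearEquiv.restrictScalars ℝ with norm_map' := e.norm_map }

lemma integral_exp_expNegSqMeasurePi {a : ι → ℝ} (ha : ∀ i, a i < 1) :
    ∫ z, Real.exp (∑ i, a i * ‖z i‖ ^ 2) ∂expNegSqMeasurePi ι = ∏ i, Real.pi / (1 - a i) := by
  rw [expNegSqMeasurePi, integral_map (by fun_prop) (by fun_prop)]
  simp only [Real.exp_sum]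
  rw [integral_fintype_prod_eq_prod (f := fun i z => Real.exp (a i * ‖z‖ ^ 2))]
  exact Finset.prod_congr rfl fun i _ => integral_exp_expNegSqMeasure (ha i)

end Gaussian

section UniformOnSphere

/-- Linear isometries act transitively on spheres. -/
lemma exists_linearIsometryEquiv_apply_eq {𝕜 E : Type*} [RCLike 𝕜] [NormedAddCommGroup E]
    [InnerProductSpace 𝕜 E] [FiniteDimensional 𝕜 E] {v w : E} (h : ‖v‖ = ‖w‖) :
    ∃ e : E ≃ₗᵢ[𝕜] E, e v = w := by
  rcases eq_or_ne v 0 with rfl | hv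
  · exact ⟨.refl 𝕜 E, by simpa [eq_comm] using h⟩
  have hv' : ‖v‖ ≠ 0 := norm_ne_zero_iff.mpr hv
  have : Nontrivial E := ⟨v, 0, hv⟩
  let i : Fin (finrank 𝕜 E) := ⟨0, finrank_pos⟩
  have hb (x : E) (hx : ‖x‖ ≠ 0) :
      ∃ b : OrthonormalBasis (Fin (finrank 𝕜 E)) 𝕜 E, (‖x‖ : 𝕜) • b i = x := by
    obtain ⟨b, hb⟩ := Orthonormal.exists_orthonormalBasis_extension_of_card_eq
      (𝕜 := 𝕜) (E := E) (ι := Fin (finrank 𝕜 E)) (by simp) (v := fun _ => (‖x‖⁻¹ : 𝕜) • x)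
      (s := {i}) ⟨fun _ => by simp [norm_smul, hx], fun a b hab => (hab (Subsingleton.elim _ _)).elim⟩
    refine ⟨b, ?_⟩
    rw [hb i rfl, smul_smul, mul_inv_cancel₀ (by exact_mod_cast hx), one_smul]
  obtain ⟨b, hbv⟩ := hb v hv'
  obtain ⟨b', hbw⟩ := hb w (h ▸ hv')
  refine ⟨b.equiv b' (Equiv.refl _), ?_⟩
  conv_lhs => rw [← hbv]
  rw [map_smul, OrthonormalBasis.equiv_apply_basis, Equiv.refl_apply, h, hbw]

variable {ι : Type*} [Fintype ι] [DecidableEq ι] {μ : Measure (EuclideanSpace ℂ ι)}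

lemma IsUniformOnSphere.map_linearIsometryEquiv (hμ : IsUniformOnSphere μ)
    (e : EuclideanSpace ℂ ι ≃ₗᵢ[ℂ] EuclideanSpace ℂ ι) : μ.map e = μ := by
  let u := Unitary.linearIsometryEquiv.symm e
  have hU : (Matrix.toEuclideanCLM (n := ι) (𝕜 := ℂ)).symm (u : _ →L[ℂ] _) ∈
      Matrix.unitaryGroup ι ℂ :=
    Unitary.map_mem (Matrix.toEuclideanCLM (n := ι) (𝕜 := ℂ)).symm u.2
  have := hμ.2.2 _ hU
  simp only [← Matrix.coe_toEuclideanCLM_eq_toEuclideanLin] at this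
  simpa [u] using this

lemma IsUniformOnSphere.charFun_eq (hμ : IsUniformOnSphere μ) {v w : EuclideanSpace ℂ ι}
    (h : ‖v‖ = ‖w‖) : charFun μ v = charFun μ w := by
  obtain ⟨e, rfl⟩ := exists_linearIsometryEquiv_apply_eq (𝕜 := ℂ) h
  let e' : EuclideanSpace ℂ ι ≃ₗᵢ[ℝ] EuclideanSpace ℂ ι :=
    { e.toLinearEquiv.restrictScalars ℝ with norm_map' := e.norm_map }
  have he (x : EuclideanSpace ℂ ι) : inner ℝ (e x) (e v) = inner ℝ x v := e'.inner_map_map x v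
  conv_rhs => rw [← hμ.map_linearIsometryEquiv e]
  rw [charFun_apply, charFun_apply, integral_map e.continuous.aemeasurable (by fun_prop)]
  simp only [he]

lemma map_qf_eq_map_sum_eigenvalues {H : Matrix ι ι ℂ} (hH : H.IsHermitian)
    (hμ : ∀ e : EuclideanSpace ℂ ι ≃ₗᵢ[ℂ] EuclideanSpace ℂ ι, μ.map e = μ) :
    μ.map (qf H) = μ.map fun z => ((∑ i, hH.eigenvalues i * ‖z i‖ ^ 2 : ℝ) : ℂ) := by
  conv_rhs => rw [← hμ hH.eigenvectorBasis.repr]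
  rw [Measure.map_map (by fun_prop) (by fun_prop)]
  congr 1
  ext u
  exact qf_of_isHermitian hH u

lemma map_qf_eq_of_charpoly_eq {H H' : Matrix ι ι ℂ} (hH : H.IsHermitian) (hH' : H'.IsHermitian)
    (hμ : ∀ e : EuclideanSpace ℂ ι ≃ₗᵢ[ℂ] EuclideanSpace ℂ ι, μ.map e = μ)
    (h : H.charpoly = H'.charpoly) : μ.map (qf H) = μ.map (qf H') := by
  rw [map_qf_eq_map_sum_eigenvalues hH hμ, map_qf_eq_map_sum_eigenvalues hH' hμ,
    (hH.eigenvalues_eq_eigenvalues_iff hH').mpr h]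

lemma integral_exp_re_qf {H : Matrix ι ι ℂ} (hH : H.IsHermitian) {x : ℝ}
    (hx : ∀ i, x * hH.eigenvalues i < 1) :
    ∫ z, Real.exp (x * (qf H z).re) ∂expNegSqMeasurePi ι =
      Real.pi ^ Fintype.card ι / ∏ i, (1 - x * hH.eigenvalues i) := by
  have hc := continuous_qf H
  rw [← integral_map (f := fun y : ℂ => Real.exp (x * y.re)) hc.aemeasurable (by fun_prop),
    map_qf_eq_map_sum_eigenvalues hH map_expNegSqMeasurePi, integral_map (by fun_prop) (by fun_prop)]
  simp only [ofReal_re, Finset.mul_sum, ← mul_assoc]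
  rw [integral_exp_expNegSqMeasurePi hx, Finset.prod_div_distrib]
  simp

lemma IsUniformOnSphere.integral_exp_re_qf_eq (hμ : IsUniformOnSphere μ) (H : Matrix ι ι ℂ)
    (x : ℝ) : ∫ z, Real.exp (x * (qf H z).re) ∂expNegSqMeasurePi ι =
      ∫ p : EuclideanSpace ℂ ι × ℂ, Real.exp (x * (‖p.1‖ ^ 2 * p.2.re))
        ∂(expNegSqMeasurePi ι).prod (μ.map (qf H)) := by
  have := hμ.1
  have hc := continuous_qf H
  conv_lhs => rw [← map_norm_smul_prod_eq_of_charFun_radial hμ.2.1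
    (fun _ _ => charFun_expNegSqMeasurePi_eq) (fun _ _ => hμ.charFun_eq)]
  conv_rhs => rw [← Measure.map_id (μ := expNegSqMeasurePi ι),
    Measure.map_prod_map _ _ measurable_id hc.measurable]
  rw [integral_map (by fun_prop) (by fun_prop), integral_map (by fun_prop) (by fun_prop)]
  simp [qf_apply_smul, ← ofReal_pow]

lemma IsUniformOnSphere.det_one_sub_smul_eq_of_map_qf_eq (hμ : IsUniformOnSphere μ)
    {H H' : Matrix ι ι ℂ} (hH : H.IsHermitian) (hH' : H'.IsHermitian)
    (h : μ.map (qf H) = μ.map (qf H')) (x : ℂ) : (1 - x • H).det = (1 - x • H').det := by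
  have hev {K : Matrix ι ι ℂ} (hK : K.IsHermitian) :
      ∀ᶠ x : ℝ in nhds 0, ∀ i, x * hK.eigenvalues i < 1 :=
    Filter.eventually_all.mpr fun i =>
      (by fun_prop : Continuous fun x : ℝ => x * hK.eigenvalues i).continuousAt.eventually_lt
        continuousAt_const (by simp)
  have hinf := infinite_of_mem_nhds (0 : ℝ) ((hev hH).and (hev hH'))
  refine det_one_sub_smul_eq_of_infinite (hinf.image ofReal_injective.injOn) ?_ x
  rintro _ ⟨x, ⟨hx, hx'⟩, rfl⟩
  have key : Real.pi ^ Fintype.card ι / ∏ i, (1 - x * hH.eigenvalues i) =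
      Real.pi ^ Fintype.card ι / ∏ i, (1 - x * hH'.eigenvalues i) := by
    rw [← integral_exp_re_qf hH hx, ← integral_exp_re_qf hH' hx', hμ.integral_exp_re_qf_eq,
      hμ.integral_exp_re_qf_eq, h]
  rw [div_eq_mul_inv, div_eq_mul_inv] at key
  replace key := inv_injective (mul_left_cancel₀ (by positivity) key)
  rw [det_one_sub_smul_of_isHermitian hH, det_one_sub_smul_of_isHermitian hH']
  exact_mod_cast congrArg ofReal key

end UniformOnSphere

/-- For `B = (w̄ / 2) A`, the Hermitian matrix `B + Bᴴ` has quadratic form `⟪qf A u, w⟫` over `ℝ`,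
so the numerical shadow of `A` is determined by those of the matrices `B + Bᴴ`. -/
lemma charFun_map_qf {ι : Type*} [Fintype ι] (μ : Measure (EuclideanSpace ℂ ι))
    (A : Matrix ι ι ℂ) (w : ℂ) :
    charFun (μ.map (qf A)) w =
      ∫ z, Complex.exp (z * I) ∂μ.map (qf ((conj w / 2) • A + ((conj w / 2) • A)ᴴ)) := by
  have hc := continuous_qf A
  have hc' := continuous_qf ((conj w / 2) • A + ((conj w / 2) • A)ᴴ)
  rw [charFun_apply, integral_map hc.aemeasurable (by fun_prop),
    integral_map hc'.aemeasurable (by fun_prop)]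
  refine integral_congr_ae (ae_of_all _ fun u => ?_)
  simp only [qf_add_conjTranspose, qf_smul]
  congr 3
  simp [Complex.inner]
  ring

section Main

variable {ι : Type*} [Fintype ι] [DecidableEq ι] {μ : Measure (EuclideanSpace ℂ ι)}
  {A : Matrix ι ι ℂ}

lemma IsUniformOnSphere.map_qf_smul_eq (hμ : IsUniformOnSphere μ)
    (h : ∀ (s : ℝ) (c : ℂ), ‖c‖ = 1 →
      (1 - (s : ℂ) • (c • A) - (s : ℂ) • (c⁻¹ • Aᴴ)).det = (1 - (s : ℂ) • A - (s : ℂ) • Aᴴ).det)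
    {c : ℂ} (hc : ‖c‖ = 1) : μ.map (qf (c • A)) = μ.map (qf A) := by
  have := hμ.1
  have key (b c : ℂ) (hc : ‖c‖ = 1) :
      μ.map (qf ((b * c) • A + ((b * c) • A)ᴴ)) = μ.map (qf (b • A + (b • A)ᴴ)) := by
    have hdet (b : ℂ) (s : ℝ) : (1 - (s : ℂ) • (b • A + (b • A)ᴴ)).det =
        (1 - ((s * ‖b‖ : ℝ) : ℂ) • A - ((s * ‖b‖ : ℝ) : ℂ) • Aᴴ).det := by
      obtain ⟨d, hd, hb⟩ : ∃ d : ℂ, ‖d‖ = 1 ∧ b = ‖b‖ * d :=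
        ⟨Complex.exp (b.arg * I), norm_exp_ofReal_mul_I _, (norm_mul_exp_arg_mul_I b).symm⟩
      rw [← h _ d hd, inv_eq_conj hd, sub_sub]
      conv_lhs => rw [hb]
      simp only [Matrix.conjTranspose_smul, star_mul', RCLike.star_def, conj_ofReal, smul_add,
        smul_smul, ofReal_mul, mul_assoc]
    refine map_qf_eq_of_charpoly_eq (Matrix.isHermitian_add_transpose_self _)
      (Matrix.isHermitian_add_transpose_self _) hμ.map_linearIsometryEquiv
      (charpoly_eq_of_det_one_sub_smul_eq
        (det_one_sub_smul_eq_of_infinite (Set.infinite_range_of_injective ofReal_injective) ?_))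
    rintro _ ⟨s, rfl⟩
    rw [hdet, hdet, norm_mul, hc, mul_one]
  refine Measure.ext_of_charFun (funext fun w => ?_)
  rw [charFun_map_qf, charFun_map_qf, smul_smul, key _ _ hc]

lemma IsUniformOnSphere.det_one_sub_smul_sub_smul_eq (hμ : IsUniformOnSphere μ)
    (h : ∀ c : ℂ, ‖c‖ = 1 → μ.map (qf (c • A)) = μ.map (qf A)) (s t : ℂ) {c : ℂ} (hc : c ≠ 0) :
    (1 - (s * c) • A - (t * c⁻¹) • Aᴴ).det = (1 - s • A - t • Aᴴ).det := by
  refine det_one_sub_smul_sub_smul_mul_eq (fun x c hc => ?_) s t hc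
  have hmap (B : Matrix ι ι ℂ) :
      μ.map (qf (B + Bᴴ)) = (μ.map (qf B)).map fun z => ((2 * z.re : ℝ) : ℂ) := by
    rw [Measure.map_map (by fun_prop) (continuous_qf B).measurable]
    congr 1
    ext u
    exact qf_add_conjTranspose B u
  have := hμ.det_one_sub_smul_eq_of_map_qf_eq (Matrix.isHermitian_add_transpose_self (c • A))
    (Matrix.isHermitian_add_transpose_self A) (by rw [hmap, hmap, h c hc]) x
  simpa only [Matrix.conjTranspose_smul, RCLike.star_def, ← inv_eq_conj hc, smul_add, smul_smul,
    ← sub_sub] using this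

end Main

/-- `A` has rotation-invariant numerical shadow iff
`det(I − s e^{iθ}A − t e^{−iθ}A*) = det(I − sA − tA*)` for all real `s, t, θ`. -/
theorem stmt_14 (N : ℕ) (hN : 1 ≤ N)
    (A : Matrix (Fin N) (Fin N) ℂ)
    [MeasurableSpace (EuclideanSpace ℂ (Fin N))] [BorelSpace (EuclideanSpace ℂ (Fin N))]
    (μ : Measure (EuclideanSpace ℂ (Fin N))) (hμ : IsUniformOnSphere μ) :
    (∀ θ : ℝ,
        μ.map (qf (Complex.exp (Complex.I * (θ : ℂ)) • A)) = μ.map (qf A)) ↔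
      (∀ s t θ : ℝ,
        Matrix.det (1 - (s : ℂ) • (Complex.exp (Complex.I * (θ : ℂ)) • A)
            - (t : ℂ) • (Complex.exp (-(Complex.I * (θ : ℂ))) • Aᴴ))
          = Matrix.det (1 - (s : ℂ) • A - (t : ℂ) • Aᴴ)) := by
  obtain rfl : ‹MeasurableSpace (EuclideanSpace ℂ (Fin N))› =
      WithLp.measurableSpace 2 (Fin N → ℂ) :=
    BorelSpace.measurable_eq.trans (@BorelSpace.measurable_eq (EuclideanSpace ℂ (Fin N)) _
      (WithLp.measurableSpace 2 (Fin N → ℂ)) inferInstance).symm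
  have hexp (θ : ℝ) : ‖Complex.exp (I * θ)‖ = 1 := by rw [mul_comm, norm_exp_ofReal_mul_I]
  constructor
  · intro h s t θ
    have hc (c : ℂ) (hc : ‖c‖ = 1) : μ.map (qf (c • A)) = μ.map (qf A) := by
      obtain ⟨θ, rfl⟩ := (norm_eq_one_iff c).mp hc
      rw [mul_comm, h]
    rw [smul_smul, smul_smul, Complex.exp_neg]
    exact hμ.det_one_sub_smul_sub_smul_eq hc s t (Complex.exp_ne_zero _)
  · intro h θ
    refine hμ.map_qf_smul_eq (fun s c hc => ?_) (hexp θ)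
    obtain ⟨θ, rfl⟩ := (norm_eq_one_iff c).mp hc
    rw [mul_comm, ← Complex.exp_neg, h]
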